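/- The ideal I_{U_I} of P generated by the homogeneous U_I-invariants of positive degree equals the ideal generated by the monomials x_s^{q^{τ(s)}} for 1 ≤ s ≤ n. Consequently, as F_q-algebras, P_{U_I} ≅ ⊗_{s=1}^n F_q[x_s]/(x_s^{q^{τ(s)}}). -/

import Mathlib

open MvPolynomial Finset

/-- The action of a matrix `g` on `F_q[x_1, …, x_n]`: the algebra map sending
`x_j` to `Σ_i g_{ij} x_i`. -/
noncomputable def matAct {K : Type*} [Field K] {n : ℕ} (g : Matrix (Fin n) (Fin n) K) :
    MvPolynomial (Fin n) K →ₐ[K] MvPolynomial (Fin n) K :=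
  aeval fun j => ∑ i, C (g i j) * X i

/-- The subalgebra of polynomials invariant under every matrix in `G`. -/
noncomputable def invariants {K : Type*} [Field K] {n : ℕ} (G : Set (GL (Fin n) K)) :
    Subalgebra K (MvPolynomial (Fin n) K) where
  carrier := {f | ∀ g ∈ G, matAct ((g : GL (Fin n) K) : Matrix (Fin n) (Fin n) K) f = f}
  mul_mem' := by
    intro a b ha hb g hg
    rw [map_mul, ha g hg, hb g hg]
  add_mem' := by
    intro a b ha hb g hg
    rw [map_add, ha g hg, hb g hg]
  algebraMap_mem' := by
    intro c g hg
    simp [matAct]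

/-- The ideal generated by the homogeneous `G`-invariants of positive degree;
the quotient by it is the algebra of coinvariants. -/
noncomputable def coinvIdeal {K : Type*} [Field K] {n : ℕ} (G : Set (GL (Fin n) K)) :
    Ideal (MvPolynomial (Fin n) K) :=
  Ideal.span {f | f ∈ invariants G ∧ ∃ d, 0 < d ∧ f.IsHomogeneous d}

/-- `tauf m s` is the largest partial sum `m i` which is `≤ s`; for `s` in the
`(j+1)`-st block this is `m j`. -/
def tauf {l : ℕ} (m : Fin (l + 1) → ℕ) (s : ℕ) : ℕ :=
  ((Finset.univ : Finset (Fin (l + 1))).filter fun i => m i ≤ s).sup m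

/-- `U_I`: block upper triangular matrices whose diagonal blocks are identity
matrices (blocks determined by the partial sums `m`). -/
def USet (K : Type*) [Field K] {l : ℕ} (n : ℕ) (m : Fin (l + 1) → ℕ) :
    Set (GL (Fin n) K) :=
  {g | ∀ s t : Fin n, tauf m (t : ℕ) ≤ tauf m (s : ℕ) →
    (g : Matrix (Fin n) (Fin n) K) s t = if s = t then 1 else 0}

/-- The global index of the `j`-th variable of the `i`-th block. -/
def emb {l : ℕ} (n : ℕ) (m : Fin (l + 1) → ℕ) (hmono : StrictMono m)
    (hlast : m (Fin.last l) = n) (i : Fin l)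
    (j : Fin (m i.succ - m i.castSucc)) : Fin n :=
  ⟨m i.castSucc + (j : ℕ), by
    have h1 : m i.succ ≤ n := hlast ▸ hmono.monotone (Fin.le_last _)
    have h2 := j.2
    omega⟩

/-- `G_I`: block upper triangular matrices whose `i`-th diagonal block lies in
`G i` (and whose entries above the diagonal blocks are arbitrary). -/
def GSet (K : Type*) [Field K] {l : ℕ} (n : ℕ) (m : Fin (l + 1) → ℕ)
    (hmono : StrictMono m) (hlast : m (Fin.last l) = n)
    (G : (i : Fin l) → Subgroup (GL (Fin (m i.succ - m i.castSucc)) K)) :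
    Set (GL (Fin n) K) :=
  {g | (∀ s t : Fin n, tauf m (t : ℕ) < tauf m (s : ℕ) →
          (g : Matrix (Fin n) (Fin n) K) s t = 0) ∧
    ∀ i : Fin l, ∃ h ∈ G i, ∀ j k : Fin (m i.succ - m i.castSucc),
      (g : Matrix (Fin n) (Fin n) K) (emb n m hmono hlast i j) (emb n m hmono hlast i k) =
        (h : Matrix (Fin (m i.succ - m i.castSucc)) (Fin (m i.succ - m i.castSucc)) K) j k}

/-- `Fpoly K k hk t = Π_{(λ_1,…,λ_k) ∈ K^k} (t + λ_1 x_1 + ⋯ + λ_k x_k)`. -/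
noncomputable def Fpoly (K : Type*) [Field K] [Fintype K] {n : ℕ} (k : ℕ) (hk : k ≤ n)
    (t : MvPolynomial (Fin n) K) : MvPolynomial (Fin n) K :=
  ∏ c : Fin k → K, (t + ∑ i : Fin k, C (c i) * X (Fin.castLE hk i))

/-- `v_{i,j} = F_{m_{i-1}}(x_{m_{i-1}+j})`. -/
noncomputable def vij (K : Type*) [Field K] [Fintype K] {l : ℕ} (n : ℕ)
    (m : Fin (l + 1) → ℕ) (hmono : StrictMono m) (hlast : m (Fin.last l) = n)
    (i : Fin l) (j : Fin (m i.succ - m i.castSucc)) : MvPolynomial (Fin n) K :=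
  Fpoly K (m i.castSucc)
    (le_trans (hmono.monotone (Fin.le_last _)) (le_of_eq hlast))
    (X (emb n m hmono hlast i j))

lemma tauf_le {l : ℕ} (m : Fin (l + 1) → ℕ) (s : ℕ) : tauf m s ≤ s :=
  Finset.sup_le fun _ hi => (Finset.mem_filter.mp hi).2

lemma tauf_le_tauf_of_tauf_le {l : ℕ} (m : Fin (l + 1) → ℕ) {s t : ℕ} (h : tauf m t ≤ s) :
    tauf m t ≤ tauf m s :=
  Finset.sup_le fun i hi => Finset.le_sup (f := m) <|
    Finset.mem_filter.mpr ⟨Finset.mem_univ i, (Finset.le_sup (f := m) hi).trans h⟩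

section Action

variable {K : Type*} [Field K] {n : ℕ}

lemma matAct_X (g : Matrix (Fin n) (Fin n) K) (j : Fin n) :
    matAct g (X j) = ∑ i, C (g i j) * X i := by
  simp [matAct]

lemma matAct_linearForm (g : Matrix (Fin n) (Fin n) K) (c : Fin n → K) :
    matAct g (∑ j, C (c j) * X j) = ∑ i, C (g.mulVec c i) * X i := by
  simp only [map_sum, map_mul, matAct_X, algHom_C, algebraMap_eq, Matrix.mulVec, dotProduct,
    Finset.sum_mul, Finset.mul_sum]
  rw [Finset.sum_comm]
  refine Finset.sum_congr rfl fun i _ => Finset.sum_congr rfl fun j _ => ?_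
  ring

lemma matAct_mul (g h : Matrix (Fin n) (Fin n) K) :
    (matAct g).comp (matAct h) = matAct (g * h) := by
  ext1 j
  rw [AlgHom.comp_apply, matAct_X h, matAct_linearForm, matAct_X]
  rfl

lemma matAct_injective (g : GL (Fin n) K) :
    Function.Injective (matAct (g : Matrix (Fin n) (Fin n) K)) := by
  have h1 : matAct (1 : Matrix (Fin n) (Fin n) K) = AlgHom.id K _ := by
    ext1 j
    simp [matAct_X, Matrix.one_apply]
  refine Function.LeftInverse.injective (g := matAct ((g⁻¹ : GL (Fin n) K) : Matrix _ _ K))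
    fun x => ?_
  rw [← AlgHom.comp_apply, matAct_mul, ← Units.val_mul, inv_mul_cancel, Units.val_one, h1]
  rfl

/-- The transvection `x_t ↦ x_t + Σ c_i x_i` (with `c_t = 0`) as an invertible matrix. -/
def shear (c : Fin n → K) (t : Fin n) (hc : c t = 0) : GL (Fin n) K where
  val := 1 + Matrix.vecMulVec c (Pi.single t 1)
  inv := 1 - Matrix.vecMulVec c (Pi.single t 1)
  val_inv := by
    have : Matrix.vecMulVec c (Pi.single t 1) * Matrix.vecMulVec c (Pi.single t 1) = 0 := by
      rw [Matrix.vecMulVec_mul_vecMulVec]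
      simp [hc]
    rw [add_mul, mul_sub, mul_sub, this]
    simp
  inv_val := by
    have : Matrix.vecMulVec c (Pi.single t 1) * Matrix.vecMulVec c (Pi.single t 1) = 0 := by
      rw [Matrix.vecMulVec_mul_vecMulVec]
      simp [hc]
    rw [sub_mul, mul_add, mul_add, this]
    simp

lemma shear_apply (c : Fin n → K) (t : Fin n) (hc : c t = 0) (i j : Fin n) :
    (shear c t hc : Matrix (Fin n) (Fin n) K) i j =
      (if i = j then 1 else 0) + if j = t then c i else 0 := by
  simp [shear, Matrix.one_apply, Matrix.vecMulVec_apply, Pi.single_apply]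

lemma matAct_shear_X (c : Fin n → K) (t : Fin n) (hc : c t = 0) (j : Fin n) :
    matAct (shear c t hc : Matrix (Fin n) (Fin n) K) (X j) =
      X j + if j = t then ∑ i, C (c i) * X i else 0 := by
  rw [matAct_X]
  simp only [shear_apply, map_add, add_mul, Finset.sum_add_distrib]
  congr 1
  · simp
  · split_ifs <;> simp

lemma shear_mem_USet {l : ℕ} (m : Fin (l + 1) → ℕ) (c : Fin n → K) (t : Fin n) (hc : c t = 0)
    (h : ∀ s : Fin n, tauf m t ≤ s → c s = 0) : shear c t hc ∈ USet K n m := by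
  intro s j hsj
  rw [shear_apply]
  by_cases hj : j = t
  · subst hj
    simp [h s (hsj.trans (tauf_le m s))]
  · simp [hj]

/-- Substitute `w` for the variable `x_t`. -/
noncomputable def substVar (t : Fin n) (w : MvPolynomial (Fin n) K) :
    MvPolynomial (Fin n) K →ₐ[K] MvPolynomial (Fin n) K :=
  aeval fun s => if s = t then w else X s

lemma substVar_X (t : Fin n) (w : MvPolynomial (Fin n) K) (s : Fin n) :
    substVar t w (X s) = if s = t then w else X s := by
  simp [substVar]

/-- Regard `f` as a univariate polynomial in the variable `x_t`. -/
noncomputable def toPolynomial (t : Fin n) :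
    MvPolynomial (Fin n) K →ₐ[K] Polynomial (MvPolynomial (Fin n) K) :=
  aeval fun s => if s = t then Polynomial.X else Polynomial.C (X s)

lemma eval_toPolynomial (t : Fin n) (w f : MvPolynomial (Fin n) K) :
    (toPolynomial t f).eval w = substVar t w f := by
  have : ((Polynomial.aeval w).restrictScalars K).comp (toPolynomial t) = substVar t w := by
    ext1 s
    simp only [AlgHom.comp_apply, toPolynomial, substVar, aeval_X]
    split_ifs <;> simp
  rw [← this]
  simp

lemma substVar_self (t : Fin n) (f : MvPolynomial (Fin n) K) : substVar t (X t) f = f := by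
  have : substVar t (X t) = AlgHom.id K (MvPolynomial (Fin n) K) := by
    ext1 s
    rw [substVar_X]
    split_ifs with h
    · simp [h]
    · simp
  rw [this]
  rfl

lemma constantCoeff_substVar_zero (t : Fin n) (f : MvPolynomial (Fin n) K) :
    constantCoeff (substVar t 0 f) = constantCoeff f := by
  have : constantCoeff.comp (substVar t 0 : MvPolynomial (Fin n) K →ₐ[K] _).toRingHom =
      constantCoeff := by
    refine MvPolynomial.ringHom_ext (fun r => by simp) fun s => ?_
    simp only [RingHom.comp_apply, AlgHom.toRingHom_eq_coe, RingHom.coe_coe, substVar_X]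
    split_ifs <;> simp
  exact RingHom.congr_fun this f

lemma MvPolynomial.algHom_eq_of_mem_supported {σ R A : Type*} [CommRing R] [CommRing A]
    [Algebra R A] {S : Set σ} {φ ψ : MvPolynomial σ R →ₐ[R] A} (h : ∀ s ∈ S, φ (X s) = ψ (X s))
    {f : MvPolynomial σ R} (hf : f ∈ supported R S) : φ f = ψ f := by
  have : supported R S ≤ AlgHom.equalizer φ ψ := by
    rw [supported_eq_adjoin_X, Algebra.adjoin_le_iff]
    rintro _ ⟨s, hs, rfl⟩
    exact h s hs
  exact this hf

lemma substVar_zero_mem_supported (t : Fin n) {f : MvPolynomial (Fin n) K}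
    (hf : f ∈ supported K {s : Fin n | (s : ℕ) < t + 1}) :
    substVar t 0 f ∈ supported K {s : Fin n | (s : ℕ) < t} := by
  have : supported K {s : Fin n | (s : ℕ) < t + 1} ≤
      (supported K {s : Fin n | (s : ℕ) < t}).comap (substVar t 0) := by
    rw [supported_eq_adjoin_X, Algebra.adjoin_le_iff]
    rintro _ ⟨s, hs, rfl⟩
    simp only [Subalgebra.coe_comap, Set.mem_preimage, SetLike.mem_coe, substVar_X]
    split_ifs with h
    · exact zero_mem _
    · refine X_mem_supported.mpr ?_
      have : (s : ℕ) ≠ t := fun h' => h (Fin.ext h')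
      simp only [Set.mem_ofPred_eq] at hs ⊢
      omega
  exact this hf

end Action

section LinearForms

variable {K : Type*} [Field K] [Fintype K] {n : ℕ}

open Classical in
/-- The finite set of linear forms in the variables `x_s`, `s < k`. -/
noncomputable def linForms (K : Type*) [Field K] [Fintype K] (n k : ℕ) :
    Finset (MvPolynomial (Fin n) K) :=
  (Fintype.piFinset fun s : Fin n => if (s : ℕ) < k then (Finset.univ : Finset K) else {0}).image
    fun c => ∑ s, C (c s) * X s

lemma mem_linForms {k : ℕ} {w : MvPolynomial (Fin n) K} :
    w ∈ linForms K n k ↔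
      ∃ c : Fin n → K, (∀ s : Fin n, k ≤ s → c s = 0) ∧ ∑ s, C (c s) * X s = w := by
  classical
  simp only [linForms, Finset.mem_image, Fintype.mem_piFinset]
  refine exists_congr fun c => and_congr_left fun _ => forall_congr' fun s => ?_
  split_ifs with h
  · simp [h]
  · simp [not_lt.mp h]

lemma card_linForms {k : ℕ} (hk : k ≤ n) : (linForms K n k).card = Fintype.card K ^ k := by
  classical
  rw [linForms, Finset.card_image_of_injective, Fintype.card_piFinset]
  · have : ∀ s : Fin n, (if (s : ℕ) < k then (Finset.univ : Finset K) else {0}).card =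
        if (s : ℕ) < k then Fintype.card K else 1 := fun s => by split_ifs <;> simp
    simp only [this]
    rw [Finset.prod_ite]
    simp only [Finset.prod_const, one_pow, mul_one]
    rw [Fin.card_filter_val_lt, min_eq_right hk]
  · intro c d h
    funext s
    have := congrArg (eval (Pi.single s 1)) h
    simpa [Pi.single_apply] using this

lemma neg_mem_linForms {k : ℕ} {w : MvPolynomial (Fin n) K} (hw : w ∈ linForms K n k) :
    -w ∈ linForms K n k := by
  obtain ⟨c, hc, rfl⟩ := mem_linForms.mp hw
  exact mem_linForms.mpr ⟨-c, fun s hs => by simp [hc s hs], by simp⟩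

lemma add_mem_linForms {k : ℕ} {v w : MvPolynomial (Fin n) K} (hv : v ∈ linForms K n k)
    (hw : w ∈ linForms K n k) : v + w ∈ linForms K n k := by
  obtain ⟨c, hc, rfl⟩ := mem_linForms.mp hv
  obtain ⟨d, hd, rfl⟩ := mem_linForms.mp hw
  exact mem_linForms.mpr ⟨c + d, fun s hs => by simp [hc s hs, hd s hs],
    by simp [add_mul, Finset.sum_add_distrib]⟩

lemma isHomogeneous_of_mem_linForms {k : ℕ} {w : MvPolynomial (Fin n) K}
    (hw : w ∈ linForms K n k) : w.IsHomogeneous 1 := by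
  obtain ⟨c, -, rfl⟩ := mem_linForms.mp hw
  exact IsHomogeneous.sum _ _ _ fun s _ => isHomogeneous_C_mul_X _ _

lemma mem_supported_of_mem_linForms {k : ℕ} {w : MvPolynomial (Fin n) K}
    (hw : w ∈ linForms K n k) : w ∈ supported K {s : Fin n | (s : ℕ) < k} := by
  obtain ⟨c, hc, rfl⟩ := mem_linForms.mp hw
  refine sum_mem fun s _ => ?_
  by_cases hs : (s : ℕ) < k
  · exact mul_mem (Subalgebra.algebraMap_mem _ (c s)) (X_mem_supported.mpr hs)
  · simp [hc s (not_lt.mp hs)]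

lemma substVar_of_mem_linForms {k : ℕ} {t : Fin n} (hk : k ≤ t) (u : MvPolynomial (Fin n) K)
    {w : MvPolynomial (Fin n) K} (hw : w ∈ linForms K n k) : substVar t u w = w := by
  refine MvPolynomial.algHom_eq_of_mem_supported (ψ := AlgHom.id K _) (fun s hs => ?_)
    (mem_supported_of_mem_linForms hw)
  have : s ≠ t := by
    rintro rfl
    simp only [Set.mem_ofPred_eq] at hs
    omega
  simp [substVar_X, this]

/-- The monic polynomial whose roots are the linear forms in `x_s`, `s < k`. -/
noncomputable def linFormsPoly (K : Type*) [Field K] [Fintype K] (n k : ℕ) :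
    Polynomial (MvPolynomial (Fin n) K) :=
  ∏ w ∈ linForms K n k, (Polynomial.X - Polynomial.C w)

lemma natDegree_linFormsPoly {k : ℕ} (hk : k ≤ n) :
    (linFormsPoly K n k).natDegree = Fintype.card K ^ k := by
  rw [linFormsPoly, Polynomial.natDegree_prod_of_monic _ _ fun _ _ => Polynomial.monic_X_sub_C _]
  simp [card_linForms hk]

lemma monic_linFormsPoly (k : ℕ) : (linFormsPoly K n k).Monic :=
  Polynomial.monic_prod_of_monic _ _ fun _ _ => Polynomial.monic_X_sub_C _

lemma isHomogeneous_coeff_prod_X_sub_C {σ R : Type*} [CommRing R]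
    (S : Finset (MvPolynomial σ R)) (hS : ∀ w ∈ S, w.IsHomogeneous 1) {j d : ℕ}
    (hjd : j + d = S.card) :
    ((∏ w ∈ S, (Polynomial.X - Polynomial.C w)).coeff j).IsHomogeneous d := by
  classical
  induction S using Finset.induction_on generalizing j d with
  | empty =>
    obtain ⟨rfl, rfl⟩ : j = 0 ∧ d = 0 := by simpa using hjd
    simpa using isHomogeneous_one σ R
  | insert w S hw ih =>
    rw [Finset.card_insert_of_notMem hw] at hjd
    have ih' : ∀ {i e : ℕ}, i + e = S.card →
        ((∏ w ∈ S, (Polynomial.X - Polynomial.C w)).coeff i).IsHomogeneous e :=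
      fun h => ih (fun v hv => hS v (Finset.mem_insert_of_mem hv)) h
    have hwS := hS w (Finset.mem_insert_self w S)
    have hmul : (w * (∏ w ∈ S, (Polynomial.X - Polynomial.C w)).coeff j).IsHomogeneous d := by
      rcases d with _ | d
      · rw [Polynomial.coeff_eq_zero_of_natDegree_lt, mul_zero]
        · exact isHomogeneous_zero _ _ _
        · cases subsingleton_or_nontrivial R
          · rw [Polynomial.natDegree_of_subsingleton]; omega
          · rw [Polynomial.natDegree_prod_of_monic _ _ fun _ _ => Polynomial.monic_X_sub_C _]
            simp only [Polynomial.natDegree_X_sub_C, Finset.sum_const, smul_eq_mul]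
            omega
      · rw [add_comm d 1]
        exact hwS.mul (ih' (by omega))
    rw [Finset.prod_insert hw, sub_mul, Polynomial.coeff_sub, Polynomial.coeff_C_mul]
    refine IsHomogeneous.sub ?_ hmul
    rcases j with _ | j
    · simpa using isHomogeneous_zero _ _ _
    · rw [Polynomial.coeff_X_mul]
      exact ih' (by omega)

lemma isHomogeneous_coeff_linFormsPoly {k j d : ℕ} (hk : k ≤ n)
    (hjd : j + d = Fintype.card K ^ k) : ((linFormsPoly K n k).coeff j).IsHomogeneous d :=
  isHomogeneous_coeff_prod_X_sub_C _ (fun _ hw => isHomogeneous_of_mem_linForms hw)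
    (by rw [hjd, card_linForms hk])

lemma coeff_linFormsPoly_mem_supported (k j : ℕ) :
    (linFormsPoly K n k).coeff j ∈ supported K {s : Fin n | (s : ℕ) < k} := by
  have : linFormsPoly K n k ∈
      Polynomial.lifts (supported K {s : Fin n | (s : ℕ) < k}).val.toRingHom := by
    refine Subsemiring.prod_mem _ fun w hw => ?_
    exact (Polynomial.lifts_iff_liftsRing _ _).mpr <| Subring.sub_mem _
      ((Polynomial.lifts_iff_liftsRing _ _).mp (Polynomial.X_mem_lifts _))
      ((Polynomial.lifts_iff_liftsRing _ _).mp
        (Polynomial.C_mem_lifts (supported K {s : Fin n | (s : ℕ) < k}).val.toRingHom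
          ⟨w, mem_supported_of_mem_linForms hw⟩))
  obtain ⟨x, hx⟩ := (Polynomial.lifts_iff_coeff_lifts _).mp this j
  rw [← hx]
  exact x.2

lemma linFormsPoly_eval_add {k : ℕ} (u : MvPolynomial (Fin n) K) {w : MvPolynomial (Fin n) K}
    (hw : w ∈ linForms K n k) :
    (linFormsPoly K n k).eval (u + w) = (linFormsPoly K n k).eval u := by
  simp only [linFormsPoly, Polynomial.eval_prod, Polynomial.eval_sub, Polynomial.eval_X,
    Polynomial.eval_C]
  refine Finset.prod_bij' (fun v _ => v + -w) (fun v _ => v + w)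
    (fun v hv => add_mem_linForms hv (neg_mem_linForms hw)) (fun v hv => add_mem_linForms hv hw)
    (by simp) (by simp) (fun v _ => by ring)

lemma pow_eq_eval_linFormsPoly_sub {k : ℕ} (hk : k ≤ n) (u : MvPolynomial (Fin n) K) :
    u ^ Fintype.card K ^ k = (linFormsPoly K n k).eval u -
      ∑ j ∈ Finset.range (Fintype.card K ^ k), (linFormsPoly K n k).coeff j * u ^ j := by
  rw [Polynomial.eval_eq_sum_range, natDegree_linFormsPoly hk, Finset.sum_range_succ,
    ← natDegree_linFormsPoly (K := K) hk, (monic_linFormsPoly k).coeff_natDegree]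
  ring

end LinearForms

section Unipotent

variable {K : Type*} [Field K] [Fintype K] {n l : ℕ} (m : Fin (l + 1) → ℕ)

/-- The ideal generated by the powers `x_s^{q^{τ(s)}}`. -/
noncomputable def powIdeal (K : Type*) [Field K] [Fintype K] (n : ℕ) {l : ℕ}
    (m : Fin (l + 1) → ℕ) : Ideal (MvPolynomial (Fin n) K) :=
  Ideal.span {f | ∃ s : Fin n, f = X s ^ (Fintype.card K ^ tauf m (s : ℕ))}

variable {m}

lemma exists_matAct_X_eq_add {g : GL (Fin n) K} (hg : g ∈ USet K n m) (t : Fin n) :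
    ∃ w ∈ linForms K n (tauf m t), matAct (g : Matrix (Fin n) (Fin n) K) (X t) = X t + w := by
  let A : Matrix (Fin n) (Fin n) K := g
  refine ⟨∑ s : Fin n, C (if tauf m t ≤ s then 0 else A s t) * X s, mem_linForms.mpr
    ⟨fun s => if tauf m t ≤ s then 0 else A s t, fun s hs => if_pos hs, rfl⟩, ?_⟩
  have hX : (X t : MvPolynomial (Fin n) K) = ∑ s, C (if s = t then 1 else 0) * X s := by simp
  rw [matAct_X, hX, ← Finset.sum_add_distrib]
  refine Finset.sum_congr rfl fun s _ => ?_
  rw [← add_mul, ← C_add]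
  congr 2
  by_cases h : tauf m t ≤ s
  · rw [if_pos h, add_zero, hg s t (tauf_le_tauf_of_tauf_le m h)]
  · have hst : s ≠ t := by
      rintro rfl
      exact h (tauf_le m s)
    rw [if_neg h, if_neg hst, zero_add]

lemma matAct_mem_linForms {g : GL (Fin n) K} (hg : g ∈ USet K n m) {k : ℕ}
    {w : MvPolynomial (Fin n) K} (hw : w ∈ linForms K n k) :
    matAct (g : Matrix (Fin n) (Fin n) K) w ∈ linForms K n k := by
  obtain ⟨c, hc, rfl⟩ := mem_linForms.mp hw
  rw [matAct_linearForm]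
  refine mem_linForms.mpr ⟨_, fun i hi => ?_, rfl⟩
  rw [Matrix.mulVec, dotProduct]
  refine Finset.sum_eq_zero fun s _ => ?_
  by_cases hs : k ≤ s
  · rw [hc s hs, mul_zero]
  · have h1 := tauf_le m s
    rw [hg i s (tauf_le_tauf_of_tauf_le m (by omega)), if_neg, zero_mul]
    rintro rfl
    exact hs hi

lemma map_matAct_linFormsPoly {g : GL (Fin n) K} (hg : g ∈ USet K n m) (k : ℕ) :
    (linFormsPoly K n k).map (matAct (g : Matrix (Fin n) (Fin n) K)).toRingHom =
      linFormsPoly K n k := by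
  classical
  have himage : (linForms K n k).image (matAct (g : Matrix (Fin n) (Fin n) K)) =
      linForms K n k := by
    refine Finset.eq_of_subset_of_card_le ?_ ?_
    · exact Finset.image_subset_iff.mpr fun w hw => matAct_mem_linForms hg hw
    · rw [Finset.card_image_of_injective _ (matAct_injective g)]
  conv_rhs => rw [linFormsPoly, ← himage, Finset.prod_image (matAct_injective g).injOn]
  simp [linFormsPoly, Polynomial.map_prod]

lemma coeff_linFormsPoly_mem_invariants (k j : ℕ) :
    (linFormsPoly K n k).coeff j ∈ invariants (USet K n m) := by
  intro g hg
  conv_rhs => rw [← map_matAct_linFormsPoly hg k, Polynomial.coeff_map]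
  rfl

lemma eval_X_linFormsPoly_mem_invariants (t : Fin n) :
    (linFormsPoly K n (tauf m t)).eval (X t) ∈ invariants (USet K n m) := by
  intro g hg
  obtain ⟨w, hw, hgt⟩ := exists_matAct_X_eq_add hg t
  have h := Polynomial.eval_map_apply (f := (matAct (g : Matrix (Fin n) (Fin n) K)).toRingHom)
    (p := linFormsPoly K n (tauf m t)) (X t)
  rw [map_matAct_linFormsPoly hg] at h
  have h' : (matAct (g : Matrix (Fin n) (Fin n) K)).toRingHom (X t) = X t + w := hgt
  rw [h', linFormsPoly_eval_add _ hw] at h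
  exact h.symm

lemma powIdeal_le_coinvIdeal : powIdeal K n m ≤ coinvIdeal (USet K n m) := by
  refine Ideal.span_le.mpr ?_
  rintro _ ⟨t, rfl⟩
  have hk : tauf m t ≤ n := (tauf_le m t).trans t.2.le
  rw [SetLike.mem_coe, pow_eq_eval_linFormsPoly_sub hk]
  refine sub_mem (Ideal.subset_span ⟨eval_X_linFormsPoly_mem_invariants t,
    Fintype.card K ^ tauf m t, pow_pos Fintype.card_pos _, ?_⟩)
    (sum_mem fun j hj => Ideal.mul_mem_right _ _ (Ideal.subset_span
      ⟨coeff_linFormsPoly_mem_invariants _ _, Fintype.card K ^ tauf m t - j, ?_, ?_⟩))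
  · rw [linFormsPoly, Polynomial.eval_prod]
    simp only [Polynomial.eval_sub, Polynomial.eval_X, Polynomial.eval_C]
    have := IsHomogeneous.prod (linForms K n (tauf m t)) (fun w => X t - w) (fun _ => 1)
      fun w hw => (isHomogeneous_X K t).sub (isHomogeneous_of_mem_linForms hw)
    simpa [card_linForms hk] using this
  · have := Finset.mem_range.mp hj
    omega
  · have := Finset.mem_range.mp hj
    exact isHomogeneous_coeff_linFormsPoly hk (by omega)

lemma substVar_eq_substVar_zero {f : MvPolynomial (Fin n) K} (hf : f ∈ invariants (USet K n m))
    {t : Fin n} {w : MvPolynomial (Fin n) K} (hw : w ∈ linForms K n (tauf m t)) :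
    substVar t w f = substVar t 0 f := by
  obtain ⟨c, hc, hcw⟩ := mem_linForms.mp hw
  have hct : c t = 0 := hc t (tauf_le m t)
  have hcomp : (substVar t 0).comp (matAct (shear c t hct : Matrix (Fin n) (Fin n) K)) =
      substVar t w := by
    ext1 s
    rw [AlgHom.comp_apply, matAct_shear_X, hcw, map_add, substVar_X, substVar_X]
    split_ifs with hs
    · rw [zero_add, substVar_of_mem_linForms (tauf_le m t) _ hw]
    · rw [map_zero, add_zero]
  rw [← hcomp, AlgHom.comp_apply, hf _ (shear_mem_USet m c t hct hc)]

lemma linFormsPoly_eval_dvd_sub_substVar {f : MvPolynomial (Fin n) K}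
    (hf : f ∈ invariants (USet K n m)) (t : Fin n) :
    (linFormsPoly K n (tauf m t)).eval (X t) ∣ f - substVar t 0 f := by
  have hdvd : linFormsPoly K n (tauf m t) ∣
      toPolynomial t f - Polynomial.C (substVar t 0 f) := by
    by_cases h0 : toPolynomial t f - Polynomial.C (substVar t 0 f) = 0
    · rw [h0]
      exact dvd_zero _
    refine (Multiset.prod_X_sub_C_dvd_iff_le_roots h0 (linForms K n (tauf m t)).val).mpr ?_
    refine (Multiset.le_iff_subset (linForms K n (tauf m t)).nodup).mpr fun w hw => ?_
    rw [Polynomial.mem_roots h0, Polynomial.IsRoot, Polynomial.eval_sub, Polynomial.eval_C,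
      eval_toPolynomial, substVar_eq_substVar_zero hf hw, sub_self]
  have := Polynomial.eval_dvd (x := X t) hdvd
  rwa [Polynomial.eval_sub, Polynomial.eval_C, eval_toPolynomial, substVar_self] at this

lemma substVar_zero_mem_invariants {f : MvPolynomial (Fin n) K}
    (hf : f ∈ invariants (USet K n m)) {t : Fin n}
    (hft : f ∈ supported K {s : Fin n | (s : ℕ) < t + 1}) :
    substVar t 0 f ∈ invariants (USet K n m) := by
  intro g hg
  obtain ⟨w, hw, hgt⟩ := exists_matAct_X_eq_add hg t
  have hcomp : ((substVar t (-w)).comp (matAct (g : Matrix (Fin n) (Fin n) K))) f =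
      ((matAct (g : Matrix (Fin n) (Fin n) K)).comp (substVar t 0)) f := by
    refine MvPolynomial.algHom_eq_of_mem_supported (fun s hs => ?_) hft
    rw [AlgHom.comp_apply, AlgHom.comp_apply, substVar_X]
    split_ifs with hst
    · rw [hst, hgt, map_add, substVar_X, if_pos rfl, substVar_of_mem_linForms (tauf_le m t) _ hw,
        neg_add_cancel, map_zero]
    · obtain ⟨v, hv, hgs⟩ := exists_matAct_X_eq_add hg s
      have hlt : (s : ℕ) < t := by
        have : (s : ℕ) ≠ t := fun h => hst (Fin.ext h)
        simp only [Set.mem_ofPred_eq] at hs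
        omega
      rw [hgs, map_add, substVar_X, if_neg hst,
        substVar_of_mem_linForms ((tauf_le m s).trans hlt.le) _ hv]
  rw [AlgHom.comp_apply, AlgHom.comp_apply, hf g hg,
    substVar_eq_substVar_zero hf (neg_mem_linForms hw)] at hcomp
  exact hcomp.symm

lemma constantCoeff_eq_zero_of_isHomogeneous {σ R : Type*} [CommSemiring R]
    {f : MvPolynomial σ R} {d : ℕ} (hd : 0 < d) (hf : f.IsHomogeneous d) :
    constantCoeff f = 0 := by
  rw [constantCoeff_eq]
  exact hf.coeff_eq_zero (by simpa using hd.ne)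

lemma mem_powIdeal_of_mem_invariants (N : ℕ) (hN : N ≤ n) {f : MvPolynomial (Fin n) K}
    (hf : f ∈ invariants (USet K n m)) (hsupp : f ∈ supported K {s : Fin n | (s : ℕ) < N})
    (h0 : constantCoeff f = 0) : f ∈ powIdeal K n m := by
  induction N generalizing f with
  | zero =>
    have hempty : {s : Fin n | (s : ℕ) < 0} = ∅ := by simp
    rw [hempty, supported_empty, Algebra.mem_bot] at hsupp
    obtain ⟨c, rfl⟩ := hsupp
    have hc : c = 0 := by simpa using h0
    rw [hc, map_zero]
    exact zero_mem _
  | succ N ih =>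
    let t : Fin n := ⟨N, hN⟩
    have hk : tauf m t ≤ N := tauf_le m t
    have hv : (linFormsPoly K n (tauf m t)).eval (X t) ∈ powIdeal K n m := by
      have hpow := pow_eq_eval_linFormsPoly_sub (K := K) (hk.trans (Nat.le_of_succ_le hN)) (X t)
      rw [eq_sub_iff_add_eq] at hpow
      rw [← hpow]
      refine add_mem (Ideal.subset_span ⟨t, rfl⟩)
        (sum_mem fun j hj => Ideal.mul_mem_right _ _ ?_)
      have hj' := Finset.mem_range.mp hj
      refine ih (Nat.le_of_succ_le hN) (coeff_linFormsPoly_mem_invariants _ _)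
        (supported_mono (fun s hs => ?_) (coeff_linFormsPoly_mem_supported _ _))
        (constantCoeff_eq_zero_of_isHomogeneous (Nat.sub_pos_of_lt hj')
          (isHomogeneous_coeff_linFormsPoly (hk.trans (Nat.le_of_succ_le hN)) (by omega)))
      exact lt_of_lt_of_le hs hk
    have hsub : f - substVar t 0 f ∈ powIdeal K n m :=
      Ideal.mem_of_dvd _ (linFormsPoly_eval_dvd_sub_substVar hf t) hv
    have hres : substVar t 0 f ∈ powIdeal K n m :=
      ih (Nat.le_of_succ_le hN) (substVar_zero_mem_invariants hf hsupp)
        (substVar_zero_mem_supported t hsupp) (by rw [constantCoeff_substVar_zero, h0])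
    simpa using add_mem hsub hres

lemma coinvIdeal_USet_eq_powIdeal : coinvIdeal (USet K n m) = powIdeal K n m := by
  refine le_antisymm (Ideal.span_le.mpr ?_) powIdeal_le_coinvIdeal
  rintro f ⟨hf, d, hd, hfd⟩
  refine mem_powIdeal_of_mem_invariants n le_rfl hf ?_
    (constantCoeff_eq_zero_of_isHomogeneous hd hfd)
  have huniv : {s : Fin n | (s : ℕ) < n} = Set.univ := by simp
  rw [huniv, supported_univ]
  exact Algebra.mem_top

end Unipotent

section TensorProduct

lemma MvPolynomial.aeval_eq_zero_of_mem_span_X_pow {R σ B : Type*} [CommRing R] [CommSemiring B]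
    [Algebra R B] {d : σ → ℕ} {b : σ → B} (hb : ∀ s, b s ^ d s = 0) {f : MvPolynomial σ R}
    (hf : f ∈ Ideal.span {f : MvPolynomial σ R | ∃ s, f = X s ^ d s}) : aeval b f = 0 := by
  have hle : Ideal.span {f : MvPolynomial σ R | ∃ s, f = X s ^ d s} ≤
      RingHom.ker (aeval b : MvPolynomial σ R →ₐ[R] B) := by
    refine Ideal.span_le.mpr ?_
    rintro _ ⟨s, rfl⟩
    rw [SetLike.mem_coe, RingHom.mem_ker, map_pow, aeval_X, hb]
  exact hle hf

/-- The quotient of a polynomial ring by the powers `x_s^{d_s}` of the variables is the tensor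
product of the truncated polynomial rings `R[x_s]/(x_s^{d_s})`. -/
theorem MvPolynomial.nonempty_quotient_span_X_pow_algEquiv_piTensorProduct {R σ : Type*}
    [CommRing R] [Fintype σ] (d : σ → ℕ) :
    Nonempty ((MvPolynomial σ R ⧸
        Ideal.span {f : MvPolynomial σ R | ∃ s, f = X s ^ d s}) ≃ₐ[R]
      PiTensorProduct R (fun s : σ =>
        Polynomial R ⧸ Ideal.span {(Polynomial.X : Polynomial R) ^ d s})) := by
  classical
  set J := Ideal.span {f : MvPolynomial σ R | ∃ s, f = X s ^ d s} with hJ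
  let A : σ → Type _ := fun s => Polynomial R ⧸ Ideal.span {(Polynomial.X : Polynomial R) ^ d s}
  let x : ∀ s, A s := fun s => Ideal.Quotient.mk _ Polynomial.X
  have hx : ∀ s, x s ^ d s = 0 := fun s => by
    rw [← map_pow]
    exact Ideal.Quotient.eq_zero_iff_mem.mpr (Ideal.mem_span_singleton_self _)
  let φ₀ : MvPolynomial σ R →ₐ[R] PiTensorProduct R A :=
    aeval fun s => PiTensorProduct.singleAlgHom s (x s)
  have hφ₀ : ∀ f ∈ J, φ₀ f = 0 := fun f hf =>
    aeval_eq_zero_of_mem_span_X_pow (fun s => by rw [← map_pow, hx, map_zero]) hf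
  let φ : (MvPolynomial σ R ⧸ J) →ₐ[R] PiTensorProduct R A := Ideal.Quotient.liftₐ J φ₀ hφ₀
  let ψ₁ : ∀ s, A s →ₐ[R] MvPolynomial σ R ⧸ J := fun s =>
    Ideal.Quotient.liftₐ _ (Polynomial.aeval (Ideal.Quotient.mk J (X s))) (by
      intro f hf
      obtain ⟨g, rfl⟩ := Ideal.mem_span_singleton.mp hf
      rw [map_mul, map_pow, Polynomial.aeval_X, ← map_pow,
        Ideal.Quotient.eq_zero_iff_mem.mpr (hJ ▸ Ideal.subset_span ⟨s, rfl⟩), zero_mul])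
  have hψ₁ : ∀ s, ψ₁ s (x s) = Ideal.Quotient.mk J (X s) := fun s => by
    change Polynomial.aeval (Ideal.Quotient.mk J (X s)) Polynomial.X = _
    simp
  let ψ : PiTensorProduct R A →ₐ[R] MvPolynomial σ R ⧸ J :=
    PiTensorProduct.liftAlgHom
      ((MultilinearMap.mkPiAlgebra R σ (MvPolynomial σ R ⧸ J)).compLinearMap
        fun s => (ψ₁ s).toLinearMap)
      (by simp) (fun a b => by simp [Finset.prod_mul_distrib])
  have hψ : ∀ s (a : A s), ψ (PiTensorProduct.singleAlgHom s a) = ψ₁ s a := by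
    intro s a
    change PiTensorProduct.lift _ (PiTensorProduct.tprod R (Pi.mulSingle s a)) = _
    rw [PiTensorProduct.lift.tprod]
    simp only [MultilinearMap.compLinearMap_apply, MultilinearMap.mkPiAlgebra_apply,
      AlgHom.toLinearMap_apply]
    rw [Finset.prod_eq_single s]
    · simp
    · intro u _ hu
      simp [Pi.mulSingle_eq_of_ne hu]
    · simp
  have hφ : ∀ s, φ (Ideal.Quotient.mk J (X s)) = PiTensorProduct.singleAlgHom s (x s) := by
    intro s
    change φ₀ (X s) = _
    simp [φ₀]
  refine ⟨AlgEquiv.ofAlgHom φ ψ ?_ ?_⟩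
  · refine PiTensorProduct.algHom_ext fun s => ?_
    refine Ideal.Quotient.algHom_ext _ ?_
    refine Polynomial.algHom_ext ?_
    change φ (ψ (PiTensorProduct.singleAlgHom s (x s))) = PiTensorProduct.singleAlgHom s (x s)
    rw [hψ, hψ₁, hφ]
  · refine Ideal.Quotient.algHom_ext _ ?_
    refine MvPolynomial.algHom_ext fun s => ?_
    change ψ (φ (Ideal.Quotient.mk J (X s))) = Ideal.Quotient.mk J (X s)
    rw [hφ, hψ, hψ₁]

end TensorProduct

open scoped TensorProduct in
/-- the ideal `I_{U_I}` generated by the homogeneous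
`U_I`-invariants of positive degree equals the ideal generated by the monomials
`x_s^{q^{τ(s)}}` (`1 ≤ s ≤ n`); consequently, as `F_q`-algebras,
`P_{U_I} ≅ ⊗_{s=1}^n F_q[x_s]/(x_s^{q^{τ(s)}})`. -/
theorem statement13 {K : Type*} [Field K] [Fintype K] {p r : ℕ} (hp : p.Prime)
    (hr : 0 < r) (hcard : Fintype.card K = p ^ r)
    (n l : ℕ) (hl : 0 < l) (m : Fin (l + 1) → ℕ)
    (hm0 : m 0 = 0) (hmono : StrictMono m) (hlast : m (Fin.last l) = n) :
    coinvIdeal (USet K n m) =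
      Ideal.span {f : MvPolynomial (Fin n) K |
        ∃ s : Fin n, f = X s ^ (Fintype.card K ^ tauf m (s : ℕ))} ∧
    Nonempty
      ((MvPolynomial (Fin n) K ⧸ coinvIdeal (USet K n m)) ≃ₐ[K]
        PiTensorProduct K (fun s : Fin n =>
          Polynomial K ⧸ Ideal.span
            {(Polynomial.X : Polynomial K) ^ (Fintype.card K ^ tauf m (s : ℕ))})) := by
  have h : coinvIdeal (USet K n m) = powIdeal K n m := coinvIdeal_USet_eq_powIdeal
  refine ⟨h, ?_⟩
  rw [h]
  exact MvPolynomial.nonempty_quotient_span_X_pow_algEquiv_piTensorProduct _
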